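/- Let W be a nonempty finite type, c : W → ℝ with 0 ≤ c w for all w and 0 < c w₀ for some w₀. Then for all f, g : W → ℝ, ∑_{w ∈ W} Q_f w * Real.log (P_g w / P_f w) = ∑_{w ∈ W} (Q_f w - P_f w) * (g w - f w) - KL(P_f ‖ P_g), where terms with Q_f w = 0 contribute 0. -/

import Mathlib

/-- The softmax (Gibbs) distribution associated with logits `f`. -/
noncomputable def softmax {W : Type*} [Fintype W] (f : W → ℝ) (w : W) : ℝ :=
  Real.exp (f w) / ∑ w', Real.exp (f w')

/-- The log-partition function of the logits `f`. -/
noncomputable def logPartition {W : Type*} [Fintype W] (f : W → ℝ) : ℝ :=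
  Real.log (∑ w, Real.exp (f w))

/-- Kullback–Leibler divergence between finitely supported densities `p` and `q`
(with the convention `0 * log 0 = 0`, which holds definitionally in `ℝ`). -/
noncomputable def KLdiv {W : Type*} [Fintype W] (p q : W → ℝ) : ℝ :=
  ∑ w, p w * Real.log (p w / q w)

/-- Marginal likelihood: the `c`-weighted total mass of the softmax distribution of `f`. -/
noncomputable def margL {W : Type*} [Fintype W] (c f : W → ℝ) : ℝ :=
  ∑ w, c w * softmax f w

/-- Posterior distribution obtained by reweighting the softmax distribution of `f`
by the evaluation weights `c` and normalizing. -/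
noncomputable def post {W : Type*} [Fintype W] (c f : W → ℝ) (w : W) : ℝ :=
  c w * softmax f w / margL c f

section

variable {W : Type*} [Fintype W]

theorem sum_exp_pos [Nonempty W] (f : W → ℝ) : 0 < ∑ w, Real.exp (f w) :=
  Finset.sum_pos (fun w _ => Real.exp_pos (f w)) Finset.univ_nonempty

theorem softmax_pos [Nonempty W] (f : W → ℝ) (w : W) : 0 < softmax f w :=
  div_pos (Real.exp_pos _) (sum_exp_pos f)

theorem sum_softmax [Nonempty W] (f : W → ℝ) : ∑ w, softmax f w = 1 := by
  simp only [softmax, ← Finset.sum_div]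
  exact div_self (sum_exp_pos f).ne'

theorem log_softmax [Nonempty W] (f : W → ℝ) (w : W) :
    Real.log (softmax f w) = f w - logPartition f := by
  rw [softmax, Real.log_div (Real.exp_pos _).ne' (sum_exp_pos f).ne', Real.log_exp, logPartition]

theorem log_softmax_div_softmax [Nonempty W] (f g : W → ℝ) (w : W) :
    Real.log (softmax g w / softmax f w) =
      (g w - f w) - (logPartition g - logPartition f) := by
  rw [Real.log_div (softmax_pos g w).ne' (softmax_pos f w).ne', log_softmax, log_softmax]
  ring

theorem margL_pos [Nonempty W] {c : W → ℝ} (hc : ∀ w, 0 ≤ c w) {w₀ : W} (hc₀ : 0 < c w₀)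
    (f : W → ℝ) : 0 < margL c f :=
  Finset.sum_pos' (fun w _ => mul_nonneg (hc w) (softmax_pos f w).le)
    ⟨w₀, Finset.mem_univ _, mul_pos hc₀ (softmax_pos f w₀)⟩

theorem sum_post {c f : W → ℝ} (h : margL c f ≠ 0) : ∑ w, post c f w = 1 := by
  simp only [post, ← Finset.sum_div]
  exact div_self h

end

/-- Identity (eq:diff:2): the posterior-weighted log-likelihood-ratio equals the
directional-derivative term minus the KL divergence between the iterates. -/
theorem posterior_weighted_ratio_eq {W : Type*} [Fintype W] [Nonempty W]
    (c : W → ℝ) (hc : ∀ w, 0 ≤ c w) (w₀ : W) (hc₀ : 0 < c w₀) (f g : W → ℝ) :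
    ∑ w, post c f w * Real.log (softmax g w / softmax f w) =
      (∑ w, (post c f w - softmax f w) * (g w - f w)) -
        KLdiv (softmax f) (softmax g) := by
  have hQ : ∑ w, post c f w = 1 := sum_post (margL_pos hc hc₀ f).ne'
  have hP : ∑ w, softmax f w = 1 := sum_softmax f
  simp only [KLdiv, log_softmax_div_softmax, mul_sub, sub_mul, Finset.sum_sub_distrib,
    ← Finset.sum_mul, hQ, hP]
  ring
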